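/- Exponential transformation of the Fokker–Planck equation (converse direction, core of the paper's Theorem 2): Let σ > 0, let b₊ : ℝⁿ × ℝ → ℝⁿ be continuously differentiable in x, and let ρ and ρ̃ be everywhere strictly positive functions on ℝⁿ × ℝ, twice continuously differentiable in x and once in t, both satisfying the Fokker–Planck equation ∂ρ/∂t + ∇·(b₊ρ) = (σ²/2)Δρ and ∂ρ̃/∂t + ∇·(b₊ρ̃) = (σ²/2)Δρ̃ at every (x,t). Define b₋ := b₊ − σ²∇log ρ and φ := −log(ρ̃/ρ). Then φ satisfies ∂φ/∂t + b₋·∇φ − (σ²/2)Δφ = −(σ²/2)∇φ·∇φ at every (x,t). -/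

import Mathlib

/-- Spatial partial derivative in direction `i` of a function `f(x,t)` on `ℝⁿ × ℝ`. -/
noncomputable def pd {n : ℕ} (i : Fin n) (f : (Fin n → ℝ) → ℝ → ℝ) :
    (Fin n → ℝ) → ℝ → ℝ :=
  fun x t => fderiv ℝ (fun y => f y t) x (Pi.single i 1)

section PartialDerivative

variable {n : ℕ} {f g : (Fin n → ℝ) → ℝ → ℝ} {x : Fin n → ℝ} {t : ℝ}

theorem pd_mul (i : Fin n) (hf : DifferentiableAt ℝ (fun y => f y t) x)
    (hg : DifferentiableAt ℝ (fun y => g y t) x) :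
    pd i (fun y s => f y s * g y s) x t = f x t * pd i g x t + g x t * pd i f x t := by
  simp [pd, fderiv_fun_mul hf hg]

theorem pd_sub (i : Fin n) (hf : DifferentiableAt ℝ (fun y => f y t) x)
    (hg : DifferentiableAt ℝ (fun y => g y t) x) :
    pd i (fun y s => f y s - g y s) x t = pd i f x t - pd i g x t := by
  simp [pd, fderiv_fun_sub hf hg]

theorem pd_log (i : Fin n) (hf : DifferentiableAt ℝ (fun y => f y t) x) (h0 : f x t ≠ 0) :
    pd i (fun y s => Real.log (f y s)) x t = pd i f x t / f x t := by
  simp [pd, fderiv.log hf h0, div_eq_inv_mul]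

theorem pd_inv (i : Fin n) (hf : DifferentiableAt ℝ (fun y => f y t) x) (h0 : f x t ≠ 0) :
    pd i (fun y s => (f y s)⁻¹) x t = -pd i f x t / f x t ^ 2 := by
  have h := ((hasDerivAt_inv h0).comp_hasFDerivAt x hf.hasFDerivAt).fderiv
  simp only [pd]
  rw [show (fun y => (f y t)⁻¹) = Inv.inv ∘ fun y => f y t from rfl, h]
  simp [div_eq_inv_mul]

theorem pd_div (i : Fin n) (hf : DifferentiableAt ℝ (fun y => f y t) x)
    (hg : DifferentiableAt ℝ (fun y => g y t) x) (h0 : g x t ≠ 0) :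
    pd i (fun y s => f y s / g y s) x t = pd i f x t / g x t - f x t * pd i g x t / g x t ^ 2 := by
  simp only [div_eq_mul_inv (f _ _)]
  rw [pd_mul i hf (g := fun y s => (g y s)⁻¹) (hg.inv h0), pd_inv i hg h0]
  ring

theorem differentiable_pd (i : Fin n) (hf : ContDiff ℝ 2 (fun y => f y t)) :
    Differentiable ℝ (fun y => pd i f y t) :=
  ((hf.fderiv_right (m := 1) (by norm_num)).differentiable (by norm_num)).clm_apply
    (differentiable_const _)

end PartialDerivative

/-- Exponential transformation of the Fokker–Planck equation (converse direction):
if the strictly positive densities `ρ` and `ρ̃` both satisfy the Fokker–Planck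
equation with forward drift `b₊` and diffusion coefficient `σ²`, then, with backward
drift `b₋ = b₊ − σ²∇log ρ`, the function `φ = −log(ρ̃/ρ)` satisfies
`∂φ/∂t + b₋·∇φ − (σ²/2)Δφ = −(σ²/2)∇φ·∇φ`. -/
theorem fokker_planck_exp_transform_converse {n : ℕ} (σ : ℝ) (hσ : 0 < σ)
    (b : Fin n → (Fin n → ℝ) → ℝ → ℝ)
    (hb : ∀ i t, ContDiff ℝ 1 (fun x => b i x t))
    (ρ ρt : (Fin n → ℝ) → ℝ → ℝ)
    (hρpos : ∀ x t, 0 < ρ x t) (hρtpos : ∀ x t, 0 < ρt x t)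
    (hρx : ∀ t, ContDiff ℝ 2 (fun x => ρ x t))
    (hρtime : ∀ x, ContDiff ℝ 1 (fun t => ρ x t))
    (hρtx : ∀ t, ContDiff ℝ 2 (fun x => ρt x t))
    (hρttime : ∀ x, ContDiff ℝ 1 (fun t => ρt x t))
    (hFP : ∀ x t, deriv (fun s => ρ x s) t
        + ∑ i, pd i (fun y s => b i y s * ρ y s) x t
        = σ ^ 2 / 2 * ∑ i, pd i (pd i ρ) x t)
    (hFPt : ∀ x t, deriv (fun s => ρt x s) t
        + ∑ i, pd i (fun y s => b i y s * ρt y s) x t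
        = σ ^ 2 / 2 * ∑ i, pd i (pd i ρt) x t) :
    ∀ x t, deriv (fun s => -Real.log (ρt x s / ρ x s)) t
        + ∑ i, (b i x t - σ ^ 2 * pd i (fun y s => Real.log (ρ y s)) x t)
            * pd i (fun y s => -Real.log (ρt y s / ρ y s)) x t
        - σ ^ 2 / 2 * ∑ i, pd i (pd i fun y s => -Real.log (ρt y s / ρ y s)) x t
        = -(σ ^ 2 / 2) * ∑ i, pd i (fun y s => -Real.log (ρt y s / ρ y s)) x t
            * pd i (fun y s => -Real.log (ρt y s / ρ y s)) x t := by
  intro x t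
  have hρ0 : ∀ x t, ρ x t ≠ 0 := fun x t => (hρpos x t).ne'
  have hρt0 : ∀ x t, ρt x t ≠ 0 := fun x t => (hρtpos x t).ne'
  have dρ : ∀ x t, DifferentiableAt ℝ (fun y => ρ y t) x := fun x t =>
    (hρx t).differentiable (by norm_num) x
  have dρt : ∀ x t, DifferentiableAt ℝ (fun y => ρt y t) x := fun x t =>
    (hρtx t).differentiable (by norm_num) x
  have hφ : (fun y s => -Real.log (ρt y s / ρ y s))
      = fun y s => Real.log (ρ y s) - Real.log (ρt y s) := by
    funext y s
    rw [Real.log_div (hρt0 y s) (hρ0 y s)]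
    ring
  have hgrad : ∀ i, pd i (fun y s => -Real.log (ρt y s / ρ y s))
      = fun y s => pd i ρ y s / ρ y s - pd i ρt y s / ρt y s := by
    intro i
    funext y s
    rw [hφ, pd_sub i (f := fun y s => Real.log (ρ y s)) (g := fun y s => Real.log (ρt y s))
      ((dρ y s).log (hρ0 y s)) ((dρt y s).log (hρt0 y s)),
      pd_log i (dρ y s) (hρ0 y s), pd_log i (dρt y s) (hρt0 y s)]
  have hhess : ∀ i, pd i (pd i fun y s => -Real.log (ρt y s / ρ y s)) x t
      = (pd i (pd i ρ) x t / ρ x t - pd i ρ x t * pd i ρ x t / ρ x t ^ 2)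
        - (pd i (pd i ρt) x t / ρt x t - pd i ρt x t * pd i ρt x t / ρt x t ^ 2) := by
    intro i
    have d₁ := differentiable_pd i (hρx t) x
    have d₂ := differentiable_pd i (hρtx t) x
    have q₁ : DifferentiableAt ℝ (fun y => pd i ρ y t / ρ y t) x := by
      simpa only [div_eq_mul_inv] using d₁.fun_mul ((dρ x t).fun_inv (hρ0 x t))
    have q₂ : DifferentiableAt ℝ (fun y => pd i ρt y t / ρt y t) x := by
      simpa only [div_eq_mul_inv] using d₂.fun_mul ((dρt x t).fun_inv (hρt0 x t))
    rw [hgrad, pd_sub i (f := fun y s => pd i ρ y s / ρ y s)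
      (g := fun y s => pd i ρt y s / ρt y s) q₁ q₂,
      pd_div i d₁ (dρ x t) (hρ0 x t), pd_div i d₂ (dρt x t) (hρt0 x t)]
  have htime : deriv (fun s => -Real.log (ρt x s / ρ x s)) t
      = deriv (fun s => ρ x s) t / ρ x t - deriv (fun s => ρt x s) t / ρt x t := by
    have e₁ := ((hρtime x).differentiable (by norm_num) t).hasDerivAt.log (hρ0 x t)
    have e₂ := ((hρttime x).differentiable (by norm_num) t).hasDerivAt.log (hρt0 x t)
    rw [congrFun hφ x]
    exact (e₁.fun_sub e₂).deriv
  have db : ∀ i, DifferentiableAt ℝ (fun y => b i y t) x := fun i =>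
    (hb i t).differentiable (by norm_num) x
  have E₁ : deriv (fun s => ρ x s) t / ρ x t = ∑ i, (σ ^ 2 / 2 * pd i (pd i ρ) x t
      - (b i x t * pd i ρ x t + ρ x t * pd i (b i) x t)) / ρ x t := by
    rw [← Finset.sum_div, Finset.sum_sub_distrib, ← Finset.mul_sum, ← hFP x t]
    simp only [fun i => pd_mul i (db i) (dρ x t), add_sub_cancel_right]
  have E₂ : deriv (fun s => ρt x s) t / ρt x t = ∑ i, (σ ^ 2 / 2 * pd i (pd i ρt) x t
      - (b i x t * pd i ρt x t + ρt x t * pd i (b i) x t)) / ρt x t := by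
    rw [← Finset.sum_div, Finset.sum_sub_distrib, ← Finset.mul_sum, ← hFPt x t]
    simp only [fun i => pd_mul i (db i) (dρt x t), add_sub_cancel_right]
  rw [htime, E₁, E₂]
  simp only [hhess]
  simp only [hgrad, fun i => pd_log i (dρ x t) (hρ0 x t)]
  rw [Finset.mul_sum, Finset.mul_sum, ← Finset.sum_sub_distrib, ← Finset.sum_add_distrib,
    ← Finset.sum_sub_distrib]
  refine Finset.sum_congr rfl fun i _ => ?_
  have h₁ := hρ0 x t
  have h₂ := hρt0 x t
  field_simp
  ring
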